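/- Let G be a connected graph on n vertices with Laplacian characteristic polynomial φ_L = λ·ξ(λ) where ξ is irreducible over ℚ with Gal(ξ) ≥ A_{n−1}. Then the Graph Fourier transform satisfies the uncertainty principle ‖f‖_0 + ‖U^T f‖_0 ≥ n + 1 for every nonzero signal f ∈ ℝ^n, where U is the orthonormal eigenvector matrix of the Laplacian. -/

import Mathlib

lemma alt_hom {α : Type*} [Fintype α] [DecidableEq α] (h2 : Fintype.card α ≠ 2)
    (Z B : Finset α) (hc : Z.card = B.card) :
    ∃ σ : Equiv.Perm α, σ ∈ alternatingGroup α ∧ ∀ i, i ∈ B → σ.symm i ∈ Z := by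
  obtain ⟨e⟩ : Nonempty ({x // x ∈ Z} ≃ {x // x ∈ B}) := by
    refine ⟨Fintype.equivOfCardEq ?_⟩
    simpa using hc
  set τ := e.extendSubtype with hτ
  have hτZ : ∀ i, i ∈ Z ↔ τ i ∈ B := fun i =>
    ⟨fun h => e.extendSubtype_mem i h, fun h => by
      by_contra hn
      exact e.extendSubtype_not_mem i hn h⟩
  rcases Int.units_eq_one_or (Equiv.Perm.sign τ) with h | h
  · refine ⟨τ, by simpa using h, fun i hi => ?_⟩
    rw [hτZ]; simpa using hi
  · have h1 : 1 < Fintype.card α := by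
      by_contra hcon
      have : Subsingleton α := Fintype.card_le_one_iff_subsingleton.mp (by omega)
      have : τ = 1 := Subsingleton.elim _ _
      rw [this] at h
      simp at h
    have key : ∃ a b, a ≠ b ∧ (a ∈ Z ↔ b ∈ Z) := by
      by_cases hz : 1 < Z.card
      · obtain ⟨a, ha, b, hb, hab⟩ := Finset.one_lt_card.mp hz
        exact ⟨a, b, hab, by simp [ha, hb]⟩
      · have : 1 < Zᶜ.card := by rw [Finset.card_compl]; omega
        obtain ⟨a, ha, b, hb, hab⟩ := Finset.one_lt_card.mp this
        rw [Finset.mem_compl] at ha hb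
        exact ⟨a, b, hab, by simp [ha, hb]⟩
    obtain ⟨a, b, hab, hiff⟩ := key
    refine ⟨τ * Equiv.swap a b, ?_, fun i hi => ?_⟩
    · rw [Equiv.Perm.mem_alternatingGroup, Equiv.Perm.sign_mul, h, Equiv.Perm.sign_swap hab]; rfl
    · have hs : ∀ x, x ∈ Z → Equiv.swap a b x ∈ Z := by
        intro x hx
        rw [Equiv.swap_apply_def]
        split_ifs <;> grind
      have : (τ * Equiv.swap a b).symm i = Equiv.swap a b (τ.symm i) := by
        rw [Equiv.symm_apply_eq]; simp
      rw [this]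
      apply hs
      rw [hτZ]; simpa using hi

/-- three vertices -/
lemma three_case (G : SimpleGraph (Fin 3)) [DecidableRel G.Adj] (hconn : G.Connected)
    (ξ : Polynomial ℚ) (hfac : (G.lapMatrix ℚ).charpoly = Polynomial.X * ξ)
    (hirr : Irreducible ξ) : False := by
  have hdeg : ∀ v, 0 < G.degree v := fun v => hconn.preconnected.degree_pos_of_nontrivial v
  have hdet : (G.lapMatrix ℚ).charpoly.eval 3 = 0 := by
    rw [Matrix.eval_charpoly, Matrix.det_fin_three]
    have h0 := hdeg 0
    have h1 := hdeg 1
    have h2 := hdeg 2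
    simp only [SimpleGraph.lapMatrix, SimpleGraph.degMatrix, SimpleGraph.adjMatrix, Matrix.sub_apply,
      Matrix.scalar_apply, Matrix.diagonal_apply, Matrix.of_apply]
    have e0 : G.degree 0 = (if G.Adj 0 1 then 1 else 0) + (if G.Adj 0 2 then 1 else 0) := by
      rw [← SimpleGraph.card_neighborFinset_eq_degree, SimpleGraph.neighborFinset_eq_filter, Finset.card_filter, Fin.sum_univ_three]
      simp
    have e1 : G.degree 1 = (if G.Adj 0 1 then 1 else 0) + (if G.Adj 1 2 then 1 else 0) := by
      rw [← SimpleGraph.card_neighborFinset_eq_degree, SimpleGraph.neighborFinset_eq_filter, Finset.card_filter, Fin.sum_univ_three]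
      simp [G.adj_comm 1 0]
    have e2 : G.degree 2 = (if G.Adj 0 2 then 1 else 0) + (if G.Adj 1 2 then 1 else 0) := by
      rw [← SimpleGraph.card_neighborFinset_eq_degree, SimpleGraph.neighborFinset_eq_filter, Finset.card_filter, Fin.sum_univ_three]
      simp [G.adj_comm 2 0, G.adj_comm 2 1]
    rw [e0] at h0; rw [e1] at h1; rw [e2] at h2
    rw [e0, e1, e2]
    by_cases a : G.Adj 0 1 <;> by_cases b : G.Adj 0 2 <;> by_cases c : G.Adj 1 2 <;>
      simp [a, b, c, G.adj_comm 1 0, G.adj_comm 2 0, G.adj_comm 2 1] at h0 h1 h2 ⊢ <;> norm_num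
  rw [hfac] at hdet
  have hr : ξ.IsRoot 3 := by simpa using hdet
  have hd1 := Polynomial.degree_eq_one_of_irreducible_of_root hirr hr
  have hd := (G.lapMatrix ℚ).charpoly_natDegree_eq_dim
  have hd2 : ξ.natDegree = 1 := Polynomial.natDegree_eq_of_degree_eq_some hd1
  rw [hfac, Polynomial.natDegree_X_mul hirr.ne_zero, hd2] at hd
  simp at hd

/-- choosing a basis among the restricted columns -/
lemma basis_choice {n : ℕ} [NeZero n] (U : Matrix (Fin n) (Fin n) ℝ) (hU : U.transpose * U = 1)
    (hU0 : ∀ v, U v 0 = 1 / Real.sqrt n) (S Z : Finset (Fin n)) (hc : Z.card = S.card)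
    (hS : S.Nonempty) :
    ∃ B : Finset (Fin n), B.card = S.card ∧ (0 ∈ B ↔ 0 ∈ Z) ∧
      ∀ f : S → ℝ, (∀ i ∈ B, ∑ s, f s * U s i = 0) → f = 0 := by
  classical
  have hn0 : (1 / Real.sqrt n : ℝ) ≠ 0 := by
    have : (0 : ℝ) < n := by exact_mod_cast Nat.pos_of_ne_zero (NeZero.ne n)
    positivity
  have hUU : U * U.transpose = 1 := mul_eq_one_comm.mp hU
  let x : Fin n → (S → ℝ) := fun i s => U s i
  -- core
  have core : ∀ a t : Set (Fin n), a ⊆ t → LinearIndepOn ℝ x a →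
      (∀ f : S → ℝ, (∀ i ∈ t, ∑ s, f s * U s i = 0) → f = 0) →
      ∃ B : Finset (Fin n), B.card = S.card ∧ (a ⊆ B) ∧ ((B : Set (Fin n)) ⊆ t) ∧
        ∀ f : S → ℝ, (∀ i ∈ B, ∑ s, f s * U s i = 0) → f = 0 := by
    intro a t hat ha ht
    obtain ⟨b, hbt, hab, hsp, hli⟩ := exists_linearIndepOn_extension ha hat
    have hinj : ∀ f : S → ℝ, (∀ i ∈ b, ∑ s, f s * U s i = 0) → f = 0 := by
      intro f hf
      apply ht
      intro i hi
      have h1 : x i ∈ Submodule.span ℝ (x '' b) := hsp ⟨i, hi, rfl⟩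
      have h2 : Submodule.span ℝ (x '' b) ≤
          LinearMap.ker (∑ s, f s • (LinearMap.proj s : (S → ℝ) →ₗ[ℝ] ℝ)) := by
        rw [Submodule.span_le]
        rintro _ ⟨j, hj, rfl⟩
        simpa [x] using hf j hj
      simpa [x] using h2 h1
    refine ⟨b.toFinset, ?_, by simpa using hab, by simpa using hbt, by simpa using hinj⟩
    apply le_antisymm
    · have := LinearIndependent.fintype_card_le_finrank hli
      rw [Set.toFinset_card]
      simpa using this
    · let T : (S → ℝ) →ₗ[ℝ] (b → ℝ) :=
        LinearMap.pi fun i => ∑ s : S, U s i • (LinearMap.proj s : (S → ℝ) →ₗ[ℝ] ℝ)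
      have hT : Function.Injective T := by
        rw [← LinearMap.ker_eq_bot, LinearMap.ker_eq_bot']
        intro f hf
        apply hinj
        intro i hi
        have := congrFun hf ⟨i, hi⟩
        simpa [T, mul_comm] using this
      have := LinearMap.finrank_le_finrank_of_injective hT
      rw [Set.toFinset_card]
      simpa using this
  -- extension by zero
  have ext0 : ∀ f : S → ℝ, ∃ F : Fin n → ℝ, (∀ s : S, F s = f s) ∧ (∀ v ∉ S, F v = 0) ∧
      ∀ i, U.transpose.mulVec F i = ∑ s, f s * U s i := by
    intro f
    refine ⟨fun v => if h : v ∈ S then f ⟨v, h⟩ else 0, fun s => by simp, fun v hv => by simp [hv], ?_⟩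
    intro i
    have : ∑ s, f s * U s i =
        ∑ s : S, (fun v => (if h : v ∈ S then f ⟨v, h⟩ else 0) * U v i) s := by simp
    rw [this, Finset.sum_coe_sort S (fun v => (if h : v ∈ S then f ⟨v, h⟩ else 0) * U v i)]
    rw [Matrix.mulVec, dotProduct]
    symm
    rw [Finset.sum_subset (Finset.subset_univ S)]
    · exact Finset.sum_congr rfl fun v _ => mul_comm _ _
    · intro v _ hv; simp [hv]
  have inv : ∀ F : Fin n → ℝ, U.mulVec (U.transpose.mulVec F) = F := by
    intro F; rw [Matrix.mulVec_mulVec, hUU, Matrix.one_mulVec]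
  by_cases hz : 0 ∈ Z
  · obtain ⟨B, h1, h2, -, h4⟩ := core {0} Set.univ (Set.subset_univ _) (by
      rw [linearIndepOn_singleton_iff]
      intro h
      obtain ⟨s, hs⟩ := hS
      have := congrFun h ⟨s, hs⟩
      simp only [x, Pi.zero_apply] at this
      rw [hU0] at this
      exact hn0 this) (by
      intro f hf
      obtain ⟨F, hF1, -, hF3⟩ := ext0 f
      have : U.transpose.mulVec F = 0 := by
        ext i; rw [hF3]; exact hf i trivial
      have h0 := inv F
      rw [this, Matrix.mulVec_zero] at h0
      ext s
      rw [← hF1, ← h0]; rfl)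
    exact ⟨B, h1, by simpa [hz] using h2, h4⟩
  · obtain ⟨B, h1, -, h3, h4⟩ := core ∅ {0}ᶜ (Set.empty_subset _) (linearIndepOn_empty _ _) (by
      intro f hf
      obtain ⟨F, hF1, hF2, hF3⟩ := ext0 f
      have hconst : ∀ v, F v = (1 / Real.sqrt n) * U.transpose.mulVec F 0 := by
        intro v
        conv_lhs => rw [← inv F]
        rw [Matrix.mulVec, dotProduct, Finset.sum_eq_single 0]
        · rw [hU0]
        · intro i _ hi
          rw [hF3, hf i (by simpa using hi), mul_zero]
        · simp
      obtain ⟨v, hv⟩ : ∃ v, v ∉ S := by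
        by_contra hcon
        push Not at hcon
        have hSu : S = Finset.univ := Finset.eq_univ_iff_forall.mpr hcon
        rw [hSu, Finset.card_univ] at hc
        rw [Finset.card_eq_iff_eq_univ] at hc
        exact hz (hc ▸ Finset.mem_univ _)
      ext s
      rw [← hF1, hconst, ← hconst v, hF2 v hv]; rfl)
    refine ⟨B, h1, ?_, h4⟩
    simp only [hz, iff_false]
    intro h0
    exact h3 h0 rfl

lemma lap_map {n : ℕ} (G : SimpleGraph (Fin n)) [DecidableRel G.Adj] {K K' : Type*} [Ring K] [Ring K']
    (φ : K →+* K') : (G.lapMatrix K).map φ = G.lapMatrix K' := by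
  ext i j
  simp only [Matrix.map_apply, SimpleGraph.lapMatrix, SimpleGraph.degMatrix, SimpleGraph.adjMatrix, Matrix.sub_apply,
      Matrix.diagonal_apply, Matrix.of_apply]
  split_ifs <;> simp

lemma eig_map {n : ℕ} (G : SimpleGraph (Fin n)) [DecidableRel G.Adj] {K K' : Type*} [Ring K] [Ring K']
    (φ : K →+* K') (w : Fin n → K) (μ : K) (h : (G.lapMatrix K).mulVec w = μ • w) :
    (G.lapMatrix K').mulVec (φ ∘ w) = φ μ • (φ ∘ w) := by
  rw [← lap_map G φ]
  ext i
  rw [← RingHom.map_mulVec, h]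
  simp

lemma eig_unique {n : ℕ} (G : SimpleGraph (Fin n)) [DecidableRel G.Adj] (lam : Fin n → ℝ)
    (hdist : Function.Injective lam)
    (U : Matrix (Fin n) (Fin n) ℝ) (hU : U.transpose * U = 1)
    (heig : ∀ i, (G.lapMatrix ℝ).mulVec (fun v => U v i) = lam i • (fun v => U v i))
    (w : Fin n → ℝ) (hw : w ≠ 0) (i : Fin n) (h : (G.lapMatrix ℝ).mulVec w = lam i • w) :
    ∃ c : ℝ, c ≠ 0 ∧ ∀ v, w v = c * U v i := by
  have hUU : U * U.transpose = 1 := mul_eq_one_comm.mp hU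
  have horth : ∀ j, j ≠ i → U.transpose.mulVec w j = 0 := by
    intro j hj
    have h1 : (fun v => U v j) ⬝ᵥ (G.lapMatrix ℝ).mulVec w = lam i * ((fun v => U v j) ⬝ᵥ w) := by
      rw [h, dotProduct_smul, smul_eq_mul]
    have h2 : (fun v => U v j) ⬝ᵥ (G.lapMatrix ℝ).mulVec w = lam j * ((fun v => U v j) ⬝ᵥ w) := by
      rw [Matrix.dotProduct_mulVec, ← Matrix.mulVec_transpose, (G.isSymm_lapMatrix (R := ℝ)).eq, heig,
        smul_dotProduct, smul_eq_mul]
    have h3 : (lam i - lam j) * ((fun v => U v j) ⬝ᵥ w) = 0 := by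
      rw [sub_mul, ← h1, ← h2, sub_self]
    rcases mul_eq_zero.mp h3 with h4 | h4
    · exact absurd (hdist (sub_eq_zero.mp h4)).symm hj
    · exact h4
  have hw' : ∀ v, w v = U.transpose.mulVec w i * U v i := by
    intro v
    have : w = U.mulVec (U.transpose.mulVec w) := by
      rw [Matrix.mulVec_mulVec, hUU, Matrix.one_mulVec]
    conv_lhs => rw [this]
    rw [Matrix.mulVec, dotProduct, Finset.sum_eq_single i]
    · rw [mul_comm]
    · intro j _ hj
      rw [horth j hj, mul_zero]
    · simp
  refine ⟨_, ?_, hw'⟩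
  intro h0
  apply hw
  ext v
  rw [hw', h0, zero_mul]; rfl



/-- For a connected graph whose Laplacian characteristic polynomial factors as
`X·ξ` with `ξ` irreducible over `ℚ` and `Gal(ξ) ≥ A_{n-1}`, the Graph Fourier transform
satisfies the uncertainty principle `‖f‖₀ + ‖U.transpose f‖₀ ≥ n + 1` for every nonzero `f`. -/
theorem stmt_14 {n : ℕ} [NeZero n] (G : SimpleGraph (Fin n)) [DecidableRel G.Adj]
    (hconn : G.Connected)
    (ξ : Polynomial ℚ)
    (hfac : (G.lapMatrix ℚ).charpoly = Polynomial.X * ξ)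
    (hirr : Irreducible ξ)
    {L : Type*} [Field L] [Algebra ℚ L]
    (lamL : Fin n → L) (ι : L →+* ℝ) (lam : Fin n → ℝ)
    (hι : ∀ i, ι (lamL i) = lam i)
    (hroot : ∀ i : Fin n, i ≠ 0 → Polynomial.aeval (lamL i) ξ = 0)
    (hdist : Function.Injective lam) (hlam0 : lam 0 = 0)
    (U : Matrix (Fin n) (Fin n) ℝ) (hU : U.transpose * U = 1)
    (hU0 : ∀ v, U v 0 = 1 / Real.sqrt n)
    (heig : ∀ i, (G.lapMatrix ℝ).mulVec (fun v => U v i) = lam i • (fun v => U v i))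
    (hGal : ∀ σ : Equiv.Perm {i : Fin n // i ≠ 0}, σ ∈ alternatingGroup {i : Fin n // i ≠ 0} →
      ∃ g : L ≃ₐ[ℚ] L, ∀ i : {i : Fin n // i ≠ 0}, g (lamL i.1) = lamL (σ i).1) :
    ∀ f : Fin n → ℝ, f ≠ 0 →
      (Finset.univ.filter fun i => f i ≠ 0).card +
        (Finset.univ.filter fun i => U.transpose.mulVec f i ≠ 0).card ≥ n + 1 := by
  classical
  intro f hf
  by_contra hcon
  push Not at hcon
  set S := Finset.univ.filter fun i => f i ≠ 0 with hSdef
  set Z0 := Finset.univ.filter fun i => ¬ (U.transpose.mulVec f i ≠ 0) with hZ0def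
  have hcard : S.card ≤ Z0.card := by
    have := Finset.card_filter_add_card_filter_not (s := (Finset.univ : Finset (Fin n)))
      (fun i => U.transpose.mulVec f i ≠ 0)
    rw [Finset.card_univ, Fintype.card_fin] at this
    have h' : (Finset.univ.filter fun i => U.transpose.mulVec f i ≠ 0).card + Z0.card = n := by
      rw [hZ0def]
      convert this
    omega
  obtain ⟨Z, hZ0, hZS⟩ := Finset.exists_subset_card_eq hcard
  have hSne : S.Nonempty := by
    obtain ⟨v, hv⟩ := Function.ne_iff.mp hf
    exact ⟨v, by simpa [hSdef] using hv⟩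
  obtain ⟨B, hBc, hB0, hB⟩ := basis_choice U hU hU0 S Z hZS hSne
  have hn3 : n ≠ 3 := by
    rintro rfl
    exact three_case G hconn ξ hfac hirr
  have hl0 : lamL 0 = 0 := by
    apply ι.injective; rw [hι, hlam0, map_zero]
  -- the Galois element
  obtain ⟨g, τ, hg, hτ⟩ : ∃ (g : L ≃ₐ[ℚ] L) (τ : Fin n → Fin n),
      (∀ j, g (lamL (τ j)) = lamL j) ∧ ∀ j ∈ B, τ j ∈ Z := by
    have hcard0 : ∀ A : Finset (Fin n), (A.subtype (fun i => i ≠ 0)).card = (A.erase 0).card := by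
      intro A
      rw [Finset.card_subtype]
      congr 1
      ext i; simp [and_comm]
    obtain ⟨σ, hσ, hσB⟩ := alt_hom (α := {i : Fin n // i ≠ 0}) (by
      rw [Fintype.card_subtype_compl]; simp; omega)
      (Z.subtype _) (B.subtype _) (by
        rw [hcard0, hcard0]
        by_cases h : 0 ∈ Z
        · rw [Finset.card_erase_of_mem h, Finset.card_erase_of_mem (hB0.mpr h), hZS, hBc]
        · rw [Finset.erase_eq_of_notMem h, Finset.erase_eq_of_notMem (fun h' => h (hB0.mp h')), hZS, hBc])
    obtain ⟨g, hg⟩ := hGal σ hσ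
    refine ⟨g, fun j => if h : j = 0 then 0 else (σ.symm ⟨j, h⟩).1, ?_, ?_⟩
    · intro j
      by_cases h : j = 0
      · simp [h, hl0]
      · simp only [h, dif_neg, not_false_eq_true]
        rw [hg]; simp
    · intro j hj
      by_cases h : j = 0
      · subst h; simpa using hB0.mp hj
      · simp only [h, dif_neg, not_false_eq_true]
        have := hσB ⟨j, h⟩ (by simpa using hj)
        simpa using this
  -- eigenvectors over `L`
  have hw : ∀ i, ∃ w : Fin n → L, w ≠ 0 ∧ (G.lapMatrix L).mulVec w = lamL i • w := by
    intro i
    have hdet : (G.lapMatrix L - Matrix.scalar (Fin n) (lamL i)).det = 0 := by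
      apply ι.injective
      rw [map_zero, RingHom.map_det, ← Matrix.exists_mulVec_eq_zero_iff]
      refine ⟨fun v => U v i, ?_, ?_⟩
      · intro h
        have h1 := congrFun (congrFun hU i) i
        rw [Matrix.mul_apply] at h1
        have h2 : ∀ v, U v i = 0 := fun v => congrFun h v
        simp [h2] at h1
      · have : ι.mapMatrix (G.lapMatrix L - Matrix.scalar (Fin n) (lamL i)) =
            G.lapMatrix ℝ - Matrix.scalar (Fin n) (lam i) := by
          rw [map_sub, RingHom.mapMatrix_apply, lap_map, ← hι]
          congr 1
          ext a b
          simp [Matrix.diagonal_apply]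
          split_ifs <;> simp
        rw [this, Matrix.sub_mulVec, heig]
        ext v
        simp
    obtain ⟨w, hw0, hw1⟩ := Matrix.exists_mulVec_eq_zero_iff.mpr hdet
    refine ⟨w, hw0, ?_⟩
    rw [Matrix.sub_mulVec, sub_eq_zero] at hw1
    rw [hw1]
    ext v
    simp [Matrix.mulVec_diagonal]
  choose w hw0 hw1 using hw
  -- transfer to `L`
  obtain ⟨fL, hfL0, hfL⟩ : ∃ fL : S → L, fL ≠ 0 ∧ ∀ i ∈ Z, ∑ s, fL s * w i s = 0 := by
    let e : S ≃ Z := Fintype.equivOfCardEq (by simpa using hZS.symm)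
    let M : Matrix S S L := Matrix.of fun s s' => w (e s') s
    have hM : M.det = 0 := by
      apply ι.injective
      rw [map_zero, RingHom.map_det, ← Matrix.exists_vecMul_eq_zero_iff]
      refine ⟨fun s => f s, ?_, ?_⟩
      · intro h
        obtain ⟨v, hv⟩ := hSne
        have h1 := congrFun h ⟨v, hv⟩
        have h2 : f v ≠ 0 := by simpa [hSdef] using hv
        exact h2 h1
      · ext s'
        have hιw : (ι ∘ w (e s')) ≠ 0 := by
          intro h
          apply hw0 (e s')
          ext v
          apply ι.injective
          simpa using congrFun h v
        obtain ⟨c, hc, hcU⟩ := eig_unique G lam hdist U hU heig (ι ∘ w (e s')) hιw (e s')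
          (by rw [← hι]; exact eig_map G ι _ _ (hw1 _))
        have hz : U.transpose.mulVec f (e s') = 0 := by
          have := hZ0 (e s').2
          simpa [hZ0def] using this
        rw [Matrix.vecMul, dotProduct]
        have h1 : ∀ s : S, f s * (ι.mapMatrix M) s s' = (fun v => c * (U v (e s') * f v)) s := by
          intro s
          have := hcU s
          simp only [Function.comp] at this
          simp only [RingHom.mapMatrix_apply, Matrix.map_apply, M, Matrix.of_apply, this]
          ring
        rw [Finset.sum_congr rfl fun s _ => h1 s,
          Finset.sum_coe_sort S (fun v => c * (U v (e s') * f v)), ← Finset.mul_sum,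
          Finset.sum_subset (Finset.subset_univ S)]
        · have : ∑ v, U v (e s') * f v = U.transpose.mulVec f (e s') := rfl
          rw [this, hz, mul_zero]; rfl
        · intro v _ hv
          have : f v = 0 := by simpa [hSdef] using hv
          rw [this, mul_zero]
    obtain ⟨fL, h0, h1⟩ := Matrix.exists_vecMul_eq_zero_iff.mpr hM
    refine ⟨fL, h0, fun i hi => ?_⟩
    have := congrFun h1 (e.symm ⟨i, hi⟩)
    simpa [Matrix.vecMul, dotProduct, M] using this
  -- apply the Galois element and go back
  let φ : L →+* ℝ := ι.comp (g : L →+* L)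
  have hfin : (fun s => φ (fL s)) = 0 := by
    apply hB
    intro j hj
    have hφw : (φ ∘ w (τ j)) ≠ 0 := by
      intro h
      apply hw0 (τ j)
      ext v
      apply φ.injective
      simpa using congrFun h v
    obtain ⟨c, hc, hcU⟩ := eig_unique G lam hdist U hU heig (φ ∘ w (τ j)) hφw j (by
      have := eig_map G φ _ _ (hw1 (τ j))
      have h2 : φ (lamL (τ j)) = lam j := by
        rw [← hι, ← hg j]; rfl
      rwa [h2] at this)
    have h1 := congrArg φ (hfL (τ j) (hτ j hj))
    rw [map_sum, map_zero] at h1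
    have h2 : c * ∑ s, φ (fL s) * U s j = 0 := by
      rw [← h1, Finset.mul_sum]
      refine Finset.sum_congr rfl fun s _ => ?_
      have := hcU s
      simp only [Function.comp] at this
      rw [map_mul, this]; ring
    exact (mul_eq_zero.mp h2).resolve_left hc
  apply hfL0
  ext s
  apply φ.injective
  rw [congrFun hfin s]; simp
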